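/- arXiv:1708.09483 — 2 statements merged into one kernel-verified Lean document; each statement's English description precedes it below -/
import Mathlib

section
/- Let S be any subset of the set of algebraic numbers α with |α| < 1 such that 0 ∈ S and S is closed under complex conjugation (α ∈ S implies the complex conjugate of α is in S). Then there exists a transcendental function f ∈ ℤ{z} whose exceptional set S_f equals S. -/
open ComplexConjugate

/-- `f : ℂ → ℂ` is, on the open unit ball, the sum of the power series with
integer coefficients `a` (i.e. `f ∈ ℤ{z}` with coefficient sequence `a`). -/
def IsIntSeries (a : ℕ → ℤ) (f : ℂ → ℂ) : Prop :=
  ∀ z : ℂ, ‖z‖ < 1 → HasSum (fun n => (a n : ℂ) * z ^ n) (f z)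

/-- The exceptional set of `f`: algebraic `α` in the open unit ball with `f α` algebraic. -/
def ExcSet (f : ℂ → ℂ) : Set ℂ :=
  {α : ℂ | IsAlgebraic ℚ α ∧ ‖α‖ < 1 ∧ IsAlgebraic ℚ (f α)}

/-- `f` is a transcendental function on the open unit ball. -/
def IsTranscendentalFn (f : ℂ → ℂ) : Prop :=
  ∀ P : MvPolynomial (Fin 2) ℂ,
    (∀ z : ℂ, ‖z‖ < 1 → MvPolynomial.eval ![z, f z] P = 0) → P = 0

open Filter Topology Polynomial

/-- The sequence of corrections in `[0, 1)` which makes all coefficients of `p + W * g` integral,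
where `W` has constant coefficient `1`. -/
noncomputable def roundingCorrection (p W : ℕ → ℝ) (n : ℕ) : ℝ :=
  ⌈p n + ∑ i : Fin n, W (n - i) * roundingCorrection p W i⌉ -
    (p n + ∑ i : Fin n, W (n - i) * roundingCorrection p W i)

lemma abs_roundingCorrection_le (p W : ℕ → ℝ) (n : ℕ) : |roundingCorrection p W n| ≤ 1 := by
  rw [roundingCorrection, abs_le]
  set s := p n + ∑ i : Fin n, W (n - i) * roundingCorrection p W i
  constructor <;> linarith [Int.le_ceil s, Int.ceil_lt_add_one s]

lemma exists_int_eq_add_mul_roundingCorrection (p W : ℕ → ℝ) (hW : W 0 = 1) (n : ℕ) :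
    ∃ m : ℤ, (m : ℝ) =
      p n + ∑ k ∈ Finset.range (n + 1), roundingCorrection p W k * W (n - k) := by
  refine ⟨⌈p n + ∑ i : Fin n, W (n - i) * roundingCorrection p W i⌉, ?_⟩
  rw [Finset.sum_range_succ, Nat.sub_self, hW, roundingCorrection, ← Fin.sum_univ_eq_sum_range
    (fun k => roundingCorrection p W k * W (n - k))]
  simp only [mul_comm (W _)]
  ring

lemma hasSum_coeff_mul_pow (P : ℝ[X]) (z : ℂ) :
    HasSum (fun n => (P.coeff n : ℂ) * z ^ n) (aeval z P) := by
  rw [aeval_eq_sum_range]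
  simp only [Algebra.smul_def, Complex.coe_algebraMap]
  refine hasSum_sum_of_ne_finset_zero fun n hn => ?_
  rw [coeff_eq_zero_of_natDegree_lt (by simpa using hn)]
  simp

lemma summable_mul_pow_of_abs_le {g : ℕ → ℝ} {B : ℝ} (hg : ∀ n, |g n| ≤ B * n + B) {z : ℂ}
    (hz : ‖z‖ < 1) : Summable fun n => ‖(g n : ℂ) * z ^ n‖ := by
  have hz' : ‖(‖z‖ : ℝ)‖ < 1 := by simpa using hz
  have h1 := (summable_pow_mul_geometric_of_norm_lt_one 1 hz').mul_left B
  have h2 := (summable_pow_mul_geometric_of_norm_lt_one 0 hz').mul_left B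
  refine (h1.add h2).of_nonneg_of_le (fun _ => norm_nonneg _) fun n => ?_
  rw [norm_mul, norm_pow, Complex.norm_real, Real.norm_eq_abs]
  calc |g n| * ‖z‖ ^ n ≤ (B * n + B) * ‖z‖ ^ n := by gcongr; exact hg n
    _ = _ := by ring

lemma exists_abs_coeff_le (P : ℝ[X]) : ∃ B : ℝ, ∀ n, |P.coeff n| ≤ B := by
  refine ⟨∑ i ∈ P.support, |P.coeff i|, fun n => ?_⟩
  by_cases hn : n ∈ P.support
  · exact Finset.single_le_sum (f := fun i => |P.coeff i|) (fun _ _ => abs_nonneg _) hn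
  · rw [notMem_support_iff.mp hn, abs_zero]
    positivity

lemma exists_sum_abs_coeff_le (P : ℝ[X]) :
    ∃ B : ℝ, ∀ n, ∑ k ∈ Finset.range (n + 1), |P.coeff (n - k)| ≤ B := by
  refine ⟨∑ i ∈ P.support, |P.coeff i|, fun n => ?_⟩
  have := Finset.sum_range_reflect (fun k => |P.coeff k|) (n + 1)
  simp only [Nat.add_sub_cancel] at this
  rw [this]
  rw [← Finset.sum_filter_ne_zero]
  refine Finset.sum_le_sum_of_subset_of_nonneg (fun i hi => ?_) fun _ _ _ => abs_nonneg _
  simpa using (Finset.mem_filter.mp hi).2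

/-- A real polynomial can be replaced by a power series with bounded integer coefficients having
the same values at the zeros in the unit disc of a polynomial with constant coefficient `1`. -/
lemma exists_bounded_int_series (W : ℝ[X]) (hW : W.coeff 0 = 1) :
    ∃ L : ℝ, ∀ (P : ℝ[X]) (B : ℝ), (∀ n, |P.coeff n| ≤ B) → ∃ h : ℕ → ℤ,
      (∀ n, |(h n : ℝ)| ≤ B + L) ∧
      ∀ z : ℂ, ‖z‖ < 1 → aeval z W = 0 →
        HasSum (fun n => (h n : ℂ) * z ^ n) (aeval z P) := by
  obtain ⟨L, hL⟩ := exists_sum_abs_coeff_le W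
  refine ⟨L, fun P B hB => ?_⟩
  set g := roundingCorrection P.coeff W.coeff with hg
  have hg1 (n) : |g n| ≤ 1 := abs_roundingCorrection_le _ _ n
  choose h hh using exists_int_eq_add_mul_roundingCorrection P.coeff W.coeff hW
  refine ⟨h, fun n => ?_, fun z hz hWz => ?_⟩
  · rw [hh]
    refine (abs_add_le _ _).trans (add_le_add (hB n) ((Finset.abs_sum_le_sum_abs _ _).trans
      ((Finset.sum_le_sum fun k _ => ?_).trans (hL n))))
    rw [abs_mul]
    exact mul_le_of_le_one_left (abs_nonneg _) (hg1 k)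
  · obtain ⟨B', hB'⟩ := exists_abs_coeff_le W
    have hB0 : 0 ≤ B' := (abs_nonneg _).trans (hB' 0)
    have hgs : Summable fun n => ‖(g n : ℂ) * z ^ n‖ :=
      summable_mul_pow_of_abs_le (B := 1) (fun n => (hg1 n).trans (by simp)) hz
    have hWs : Summable fun n => ‖(W.coeff n : ℂ) * z ^ n‖ :=
      summable_mul_pow_of_abs_le (B := B')
        (fun n => (hB' n).trans (le_add_of_nonneg_left (by positivity))) hz
    have hprod := (summable_norm_sum_mul_range_of_summable_norm hgs hWs).of_norm.hasSum
    rw [← tsum_mul_tsum_eq_tsum_sum_range_of_summable_norm hgs hWs,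
      (hasSum_coeff_mul_pow W z).tsum_eq, hWz, mul_zero] at hprod
    have := (hasSum_coeff_mul_pow P z).add hprod
    rw [add_zero] at this
    convert this using 1
    funext n
    have hc : (h n : ℂ) = ((h n : ℝ) : ℂ) := by simp
    rw [hc, hh, Complex.ofReal_add, Complex.ofReal_sum, add_mul, Finset.sum_mul]
    congr 1
    refine Finset.sum_congr rfl fun k hk => ?_
    rw [← Nat.add_sub_of_le (Nat.lt_succ_iff.mp (Finset.mem_range.mp hk)), pow_add]
    simp only [Nat.add_sub_cancel_left]
    push_cast
    ring

lemma isAlgebraic_conj_iff {z : ℂ} : IsAlgebraic ℚ (conj z) ↔ IsAlgebraic ℚ z :=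
  isAlgebraic_algHom_iff ((Complex.conjAe : ℂ →ₐ[ℝ] ℂ).restrictScalars ℚ)
    (star_injective (R := ℂ))

lemma exists_transcendental_affine (v : ℂ) {u : ℂ} (hu : u ≠ 0) :
    ∃ a : ℝ, |a| ≤ 1 ∧ ¬ IsAlgebraic ℚ (v + u * a) := by
  by_contra! H
  have hinj : Function.Injective fun a : ℝ => v + u * (a : ℂ) := fun a b hab => by
    simpa [hu] using hab
  have hc : (Set.Icc (0 : ℝ) 1).Countable :=
    ((Algebraic.countable ℚ ℂ).preimage hinj).mono fun a ha =>
      H a (abs_le.mpr ⟨by linarith [ha.1], ha.2⟩)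
  exact absurd (Cardinal.Real.Icc_countable_iff.mp hc) (by norm_num)

lemma exists_isAlgebraic_norm_sub_lt (v : ℂ) {ε : ℝ} (hε : 0 < ε) :
    ∃ x : ℂ, IsAlgebraic ℚ x ∧ ‖x - v‖ < ε ∧ (v.im = 0 → x.im = 0) := by
  obtain ⟨p, hp1, hp2⟩ := exists_rat_btwn (lt_add_of_pos_right v.re (half_pos hε))
  have hp : |(p : ℝ) - v.re| < ε / 2 := by rw [abs_lt]; constructor <;> linarith
  obtain ⟨q, hq, hq0⟩ : ∃ q : ℚ, |(q : ℝ) - v.im| < ε / 2 ∧ (v.im = 0 → q = 0) := by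
    by_cases h : v.im = 0
    · exact ⟨0, by simp [h, hε], fun _ => rfl⟩
    · obtain ⟨q, hq1, hq2⟩ := exists_rat_btwn (lt_add_of_pos_right v.im (half_pos hε))
      exact ⟨q, by rw [abs_lt]; constructor <;> linarith, fun h' => absurd h' h⟩
  refine ⟨p + q * Complex.I, ?_, ?_, fun h => by simp [hq0 h]⟩
  · have hI : IsAlgebraic ℚ Complex.I := (Complex.isIntegral_rat_I).isAlgebraic
    exact (isAlgebraic_algebraMap (R := ℚ) (A := ℂ) p).add
      ((isAlgebraic_algebraMap (R := ℚ) (A := ℂ) q).mul hI)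
  · refine (Complex.norm_le_abs_re_add_abs_im _).trans_lt ?_
    simp
    linarith

lemma exists_isAlgebraic_affine (v : ℂ) {u z : ℂ} (hu : u ≠ 0)
    (hreal : z.im = 0 → v.im = 0 ∧ u.im = 0) :
    ∃ a b : ℝ, |a| ≤ 1 ∧ |b| ≤ 1 ∧ IsAlgebraic ℚ (v + u * (a + b * z)) := by
  have hu' : 0 < ‖u‖ := norm_pos_iff.mpr hu
  by_cases hz : z.im = 0
  · obtain ⟨hv, hui⟩ := hreal hz
    obtain ⟨x, hx, hxv, hxi⟩ := exists_isAlgebraic_norm_sub_lt v hu'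
    have hxi := hxi hv
    have hur : u = (u.re : ℂ) := Complex.ext rfl (by simp [hui])
    have hvr : v = (v.re : ℂ) := Complex.ext rfl (by simp [hv])
    have hxr : x = (x.re : ℂ) := Complex.ext rfl (by simp [hxi])
    have hur0 : u.re ≠ 0 := fun h => hu (by rw [hur, h]; simp)
    refine ⟨(x.re - v.re) / u.re, 0, ?_, by simp, ?_⟩
    · rw [abs_div, div_le_one (abs_pos.mpr hur0)]
      rw [hxr, hvr, hur, ← Complex.ofReal_sub, Complex.norm_real, Complex.norm_real] at hxv
      exact hxv.le
    · convert hx using 1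
      rw [hxr, hvr, hur]
      have : (u.re : ℂ) ≠ 0 := by exact_mod_cast hur0
      simp
      field_simp
      ring
  · set ε := min |z.im| (1 / (1 + |z.re| / |z.im|)) with hε
    have hz' : 0 < |z.im| := abs_pos.mpr hz
    have hε0 : 0 < ε := lt_min hz' (by positivity)
    obtain ⟨x, hx, hxv, -⟩ := exists_isAlgebraic_norm_sub_lt v (mul_pos hu' hε0)
    set c := (x - v) / u with hc
    have hcn : ‖c‖ < ε := by rwa [hc, norm_div, div_lt_iff₀ hu', mul_comm]
    have him := Complex.abs_im_le_norm c
    have hre := Complex.abs_re_le_norm c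
    refine ⟨c.re - c.im / z.im * z.re, c.im / z.im, ?_, ?_, ?_⟩
    · have h1 : |c.im / z.im * z.re| ≤ ‖c‖ * (|z.re| / |z.im|) := by
        rw [abs_mul, abs_div, div_mul_eq_mul_div, mul_div_assoc]
        gcongr
      have h2 : ‖c‖ * (1 + |z.re| / |z.im|) ≤ 1 := by
        have := hcn.le.trans (min_le_right _ _)
        rwa [le_div_iff₀ (by positivity)] at this
      refine (abs_sub _ _).trans ?_
      linarith
    · rw [abs_div, div_le_one hz']
      linarith [min_le_left |z.im| (1 / (1 + |z.re| / |z.im|))]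
    · convert hx using 1
      have h1 : ((c.re - c.im / z.im * z.re : ℝ) : ℂ) + ((c.im / z.im : ℝ) : ℂ) * z = c := by
        apply Complex.ext
        · simp
        · simp [hz]
      rw [h1, hc]
      field_simp
      ring

lemma eval_equivMvPolynomial (Q : ℂ[X][X]) (z w : ℂ) :
    MvPolynomial.eval ![z, w] (Polynomial.Bivariate.equivMvPolynomial ℂ Q) =
      ∑ i ∈ Finset.range (Q.natDegree + 1), (Q.coeff i).eval z * w ^ i := by
  have h : (MvPolynomial.eval ![z, w]).comp
      (Polynomial.Bivariate.equivMvPolynomial ℂ : ℂ[X][X] →+* MvPolynomial (Fin 2) ℂ) =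
      eval₂RingHom (evalRingHom z) w := by
    ext <;> simp
  have h' := RingHom.congr_fun h Q
  simp only [RingHom.comp_apply, coe_eval₂RingHom, eval₂_eq_sum_range] at h'
  exact h'

/-- A function growing faster than every power of `1 / (1 - r)` as `r → 1⁻` along some sequence is
transcendental. -/
lemma isTranscendentalFn_of_frequently_lt {f : ℂ → ℂ}
    (hf : ∀ (K : ℕ) (C : ℝ), ∃ᶠ r : ℝ in 𝓝[<] 1, C < (1 - r) ^ K * ‖f r‖) :
    IsTranscendentalFn f := by
  intro P hP
  obtain ⟨Q, rfl⟩ := (Polynomial.Bivariate.equivMvPolynomial ℂ).surjective P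
  by_contra hne
  have hQ : Q ≠ 0 := fun h => hne (by rw [h, map_zero])
  set d := Q.natDegree
  obtain ⟨q, hq, hqd⟩ := exists_eq_pow_rootMultiplicity_mul_and_not_dvd (Q.coeff d)
    (leadingCoeff_ne_zero.mpr hQ) 1
  set m := (Q.coeff d).rootMultiplicity 1
  rw [dvd_iff_isRoot, IsRoot.def] at hqd
  set δ := ‖q.eval 1‖ / 2 with hδ
  have hδ0 : 0 < δ := half_pos (norm_pos_iff.mpr hqd)
  set S : ℝ → ℝ := fun r => ∑ i ∈ Finset.range d, ‖(Q.coeff i).eval (r : ℂ)‖ with hS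
  have hScont : Continuous S := by fun_prop
  have hqcont : Continuous fun r : ℝ => ‖q.eval (r : ℂ)‖ := by fun_prop
  have e1 : ∀ᶠ r in 𝓝[<] (1 : ℝ), S r < S 1 + 1 :=
    (hScont.tendsto 1).mono_left nhdsWithin_le_nhds |>.eventually_lt_const (by linarith)
  have e2 : ∀ᶠ r : ℝ in 𝓝[<] (1 : ℝ), δ < ‖q.eval (r : ℂ)‖ :=
    (hqcont.tendsto 1).mono_left nhdsWithin_le_nhds |>.eventually_const_lt
      (by simp only [Complex.ofReal_one, hδ]; linarith)
  have e3 : ∀ᶠ r in 𝓝[<] (1 : ℝ), r ∈ Set.Ioo (0 : ℝ) 1 := Ioo_mem_nhdsLT zero_lt_one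
  obtain ⟨r, hr, h1, h2, hr0, hr1⟩ :=
    ((hf m (max 1 ((S 1 + 1) / δ))).and_eventually (e1.and (e2.and e3))).exists
  have hnr : ‖(r : ℂ)‖ < 1 := by rwa [Complex.norm_real, Real.norm_of_nonneg hr0.le]
  have hzero := hP r hnr
  rw [eval_equivMvPolynomial, Finset.sum_range_succ] at hzero
  have hw : 1 ≤ ‖f r‖ := by
    refine ((le_max_left _ _).trans hr.le).trans (mul_le_of_le_one_left (norm_nonneg _) ?_)
    exact pow_le_one₀ (by linarith) (by linarith)
  have hlead : ‖(Q.coeff d).eval (r : ℂ)‖ = (1 - r) ^ m * ‖q.eval (r : ℂ)‖ := by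
    conv_lhs => rw [hq]
    rw [eval_mul, norm_mul, eval_pow, norm_pow, eval_sub, eval_X, eval_C, ← Complex.ofReal_one,
      ← Complex.ofReal_sub, Complex.norm_real, Real.norm_of_nonpos (by linarith), neg_sub]
  have hmain : ‖(Q.coeff d).eval (r : ℂ)‖ * ‖f r‖ * ‖f r‖ ^ d ≤ S r * ‖f r‖ ^ d := by
    have h3 : ‖(Q.coeff d).eval (r : ℂ)‖ * ‖f r‖ ^ d ≤
        ∑ i ∈ Finset.range d, ‖(Q.coeff i).eval (r : ℂ)‖ * ‖f r‖ ^ i := by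
      rw [← norm_pow, ← norm_mul, eq_neg_of_add_eq_zero_right hzero, norm_neg]
      refine (norm_sum_le _ _).trans_eq (Finset.sum_congr rfl fun i _ => ?_)
      rw [norm_mul, norm_pow]
    calc _ = ‖(Q.coeff d).eval (r : ℂ)‖ * ‖f r‖ ^ d * ‖f r‖ := by ring
      _ ≤ (∑ i ∈ Finset.range d, ‖(Q.coeff i).eval (r : ℂ)‖ * ‖f r‖ ^ i) * ‖f r‖ := by gcongr
      _ ≤ _ := by
        rw [hS, Finset.sum_mul, Finset.sum_mul]
        refine Finset.sum_le_sum fun i hi => ?_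
        rw [mul_assoc, ← pow_succ]
        gcongr
        exact Finset.mem_range.mp hi
  have h4 := le_of_mul_le_mul_right hmain (pow_pos (zero_lt_one.trans_le hw) d)
  have h5 : (S 1 + 1) / δ < (1 - r) ^ m * ‖f r‖ := (le_max_right _ _).trans_lt hr
  rw [div_lt_iff₀ hδ0] at h5
  rw [hlead] at h4
  have h6 : (1 - r) ^ m * ‖f r‖ * δ ≤ (1 - r) ^ m * ‖f r‖ * ‖q.eval (r : ℂ)‖ := by
    have : 0 ≤ 1 - r := by linarith
    gcongr
  linarith

lemma summable_two_pow_sqrt_mul_pow {x : ℝ} (hx0 : 0 ≤ x) (hx : x < 1) :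
    Summable fun n : ℕ => (2 : ℝ) ^ n.sqrt * x ^ n := by
  set t := √x
  have ht0 : 0 ≤ t := Real.sqrt_nonneg x
  have ht : t < 1 := by rwa [Real.sqrt_lt' one_pos, one_pow]
  have hsqrt : Tendsto Nat.sqrt atTop atTop :=
    tendsto_atTop.mpr fun k => eventually_atTop.mpr ⟨k * k, fun n hn => Nat.le_sqrt.mpr hn⟩
  have hev : ∀ᶠ s : ℕ in atTop, t ^ s < 1 / 2 :=
    (tendsto_pow_atTop_nhds_zero_of_lt_one ht0 ht).eventually_lt_const (by norm_num)
  refine Summable.of_norm_bounded_eventually_nat (summable_geometric_of_lt_one ht0 ht) ?_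
  filter_upwards [hsqrt.eventually hev] with n hn
  rw [Real.norm_of_nonneg (by positivity)]
  have hxt : x ^ n = t ^ n * t ^ n := by rw [← mul_pow, Real.mul_self_sqrt hx0]
  have h1 : t ^ n ≤ (t ^ n.sqrt) ^ n.sqrt := by
    rw [← pow_mul]
    exact pow_le_pow_of_le_one ht0 ht.le (Nat.sqrt_le n)
  calc (2 : ℝ) ^ n.sqrt * x ^ n = 2 ^ n.sqrt * t ^ n * t ^ n := by rw [hxt, mul_assoc]
    _ ≤ 2 ^ n.sqrt * (t ^ n.sqrt) ^ n.sqrt * t ^ n := by gcongr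
    _ = (2 * t ^ n.sqrt) ^ n.sqrt * t ^ n := by rw [mul_pow]
    _ ≤ 1 * t ^ n := by
      gcongr
      exact pow_le_one₀ (by positivity) (by linarith)
    _ = t ^ n := one_mul _

lemma frequently_lt_of_abs_sub_two_pow_sqrt_le {a : ℕ → ℤ} {f : ℂ → ℂ}
    (ha : ∀ n, |(a n : ℝ) - 2 ^ n.sqrt| ≤ 2 * n)
    (hf : ∀ z : ℂ, ‖z‖ < 1 → HasSum (fun n => (a n : ℂ) * z ^ n) (f z)) (K : ℕ) (C : ℝ) :
    ∃ᶠ r : ℝ in 𝓝[<] 1, C < (1 - r) ^ K * ‖f r‖ := by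
  have hlow {r : ℝ} (hr0 : 0 < r) (hr1 : r < 1) (n : ℕ) :
      (2 : ℝ) ^ n.sqrt * r ^ n - 2 / (1 - r) ^ 2 ≤ ‖f r‖ := by
    have hnr : ‖(r : ℂ)‖ < 1 := by rwa [Complex.norm_real, Real.norm_of_nonneg hr0.le]
    have hnr' : ‖r‖ < 1 := by rwa [Real.norm_of_nonneg hr0.le]
    have h1 := Complex.hasSum_re (hf r hnr)
    have h2 := (summable_two_pow_sqrt_mul_pow hr0.le hr1).hasSum
    have h3 := (hasSum_coe_mul_geometric_of_norm_lt_one hnr').mul_left 2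
    have h4 := hasSum_le (fun n => ?_) (h2.sub h3) h1
    · have h5 : (2 : ℝ) ^ n.sqrt * r ^ n ≤ ∑' n : ℕ, (2 : ℝ) ^ n.sqrt * r ^ n :=
        h2.summable.le_tsum n fun _ _ => by positivity
      have h6 : 2 * (r / (1 - r) ^ 2) ≤ 2 / (1 - r) ^ 2 := by
        rw [← mul_div_assoc]
        gcongr
        linarith
      linarith [Complex.re_le_norm (f r)]
    · rw [← Complex.ofReal_pow, ← Complex.ofReal_intCast, ← Complex.ofReal_mul, Complex.ofReal_re,
        ← mul_assoc, ← sub_mul]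
      gcongr
      linarith [(abs_le.mp (ha n)).1]
  have hlim : Tendsto (fun s : ℕ => C * 2 ^ K * ((s : ℝ) ^ (2 * K) / 2 ^ s) +
      8 * ((s : ℝ) ^ 4 / 2 ^ s)) atTop (𝓝 0) := by
    have h (k : ℕ) := tendsto_pow_const_div_const_pow_of_one_lt k (one_lt_two (α := ℝ))
    simpa using ((h (2 * K)).const_mul (C * 2 ^ K)).add ((h 4).const_mul 8)
  have hr : Tendsto (fun s : ℕ => 1 - 1 / (2 * (s : ℝ) ^ 2)) atTop (𝓝[<] 1) := by
    refine tendsto_nhdsWithin_iff.mpr ⟨?_, ?_⟩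
    · have : Tendsto (fun s : ℕ => 2 * (s : ℝ) ^ 2) atTop atTop :=
        ((tendsto_pow_atTop two_ne_zero).comp tendsto_natCast_atTop_atTop).const_mul_atTop two_pos
      simpa using (tendsto_const_nhds (x := (1 : ℝ))).sub this.inv_tendsto_atTop
    · filter_upwards [eventually_gt_atTop 0] with s hs
      have : (0 : ℝ) < s := by exact_mod_cast hs
      have : 0 < 1 / (2 * (s : ℝ) ^ 2) := by positivity
      simpa only [Set.mem_Iio, sub_lt_self_iff] using this
  refine hr.frequently (Eventually.frequently ?_)
  filter_upwards [hlim.eventually_lt_const (show (0 : ℝ) < 1 / 2 by norm_num),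
    eventually_gt_atTop 0] with s hs hs0
  have hs1 : (1 : ℝ) ≤ s := by exact_mod_cast hs0
  have hs2 : (1 : ℝ) ≤ (s : ℝ) ^ 2 := one_le_pow₀ hs1
  set x := 1 / (2 * (s : ℝ) ^ 2) with hx
  have hx0 : 0 < x := by positivity
  have hx1 : x ≤ 1 / 2 := by
    rw [hx]
    exact one_div_le_one_div_of_le two_pos (by linarith)
  have h1 := hlow (r := 1 - x) (by linarith) (by linarith) (s ^ 2)
  have hbern := one_add_mul_le_pow (a := -x) (by linarith) (s ^ 2)
  have hsx : ((s ^ 2 : ℕ) : ℝ) * x = 1 / 2 := by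
    rw [hx]; push_cast; field_simp
  rw [mul_neg, hsx, ← sub_eq_add_neg] at hbern
  rw [Nat.sqrt_eq', sub_sub_cancel] at h1
  have h2 : (2 : ℝ) ^ s * (1 / 2) ≤ 2 ^ s * (1 - x) ^ (s ^ 2) := by
    gcongr
    rw [← sub_eq_add_neg] at hbern
    linarith
  have h3 : 2 / x ^ 2 = 8 * (s : ℝ) ^ 4 := by rw [hx]; field_simp; norm_num
  rw [sub_sub_cancel]
  have h4 : C * 2 ^ K * (s : ℝ) ^ (2 * K) + 8 * (s : ℝ) ^ 4 < 2 ^ s * (1 / 2) := by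
    have := mul_lt_mul_of_pos_left hs (show (0 : ℝ) < 2 ^ s by positivity)
    have h2s : (2 : ℝ) ^ s ≠ 0 := by positivity
    calc _ = 2 ^ s * (C * 2 ^ K * ((s : ℝ) ^ (2 * K) / 2 ^ s) + 8 * ((s : ℝ) ^ 4 / 2 ^ s)) := by
          field_simp
      _ < _ := this
  have h5 : C * 2 ^ K * (s : ℝ) ^ (2 * K) < ‖f ↑(1 - x)‖ := by linarith
  have h6 : x ^ K * (C * 2 ^ K * (s : ℝ) ^ (2 * K)) = C := by
    have : x * (2 * (s : ℝ) ^ 2) = 1 := by rw [hx]; field_simp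
    calc _ = C * (x * (2 * (s : ℝ) ^ 2)) ^ K := by rw [mul_pow, mul_pow, ← pow_mul]; ring
      _ = C := by rw [this, one_pow, mul_one]
  rw [← h6]
  exact mul_lt_mul_of_pos_left h5 (pow_pos hx0 K)

/-- The sum of the power series with integer coefficients `a`. -/
noncomputable def intSum (a : ℕ → ℤ) (z : ℂ) : ℂ := ∑' n, (a n : ℂ) * z ^ n

lemma intSum_conj (a : ℕ → ℤ) (z : ℂ) : intSum a (conj z) = conj (intSum a z) := by
  simp [intSum, Complex.conj_tsum]

lemma summable_and_norm_intSum_sub_le {a b : ℕ → ℤ} {ε : ℝ}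
    (hab : ∀ n, |(a n : ℝ) - b n| ≤ ε * n) {z : ℂ} (hz : ‖z‖ < 1)
    (hb : Summable fun n => (b n : ℂ) * z ^ n) :
    (Summable fun n => (a n : ℂ) * z ^ n) ∧
      ‖intSum a z - intSum b z‖ ≤ ε * (‖z‖ / (1 - ‖z‖) ^ 2) := by
  have hz' : ‖(‖z‖ : ℝ)‖ < 1 := by simpa using hz
  have hg := (hasSum_coe_mul_geometric_of_norm_lt_one hz').mul_left ε
  have hle (n : ℕ) : ‖(a n : ℂ) * z ^ n - (b n : ℂ) * z ^ n‖ ≤ ε * (n * ‖z‖ ^ n) := by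
    rw [← sub_mul, norm_mul, norm_pow, ← mul_assoc]
    gcongr
    have := hab n
    rwa [← Real.norm_eq_abs, ← Complex.norm_real, Complex.ofReal_sub, Complex.ofReal_intCast,
      Complex.ofReal_intCast] at this
  have hs := Summable.of_norm_bounded hg.summable hle
  have ha : Summable fun n => (a n : ℂ) * z ^ n := by simpa using hs.add hb
  refine ⟨ha, ?_⟩
  rw [intSum, intSum, ← ha.tsum_sub hb]
  exact tsum_of_norm_bounded hg hle

lemma hasSum_ite_lt_mul_pow {h : ℕ → ℤ} {z s : ℂ} (hs : HasSum (fun n => (h n : ℂ) * z ^ n) s)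
    (N : ℕ) :
    HasSum (fun n => ((if n < N then 0 else h (n - N) : ℤ) : ℂ) * z ^ n) (z ^ N * s) := by
  rw [← hasSum_nat_add_iff' N, Finset.sum_eq_zero, sub_zero]
  · have h' := hs.mul_left (z ^ N)
    simp only [add_lt_iff_neg_right, Nat.not_lt_zero, if_false, Nat.add_sub_cancel, pow_add]
    simpa only [mul_assoc, mul_comm, mul_left_comm] using h'
  · intro i hi
    simp [Finset.mem_range.mp hi]

/-- The coefficient sequence `a` has the prescribed behaviour at the zeros of `W` in the unit
disc: its sum is algebraic there exactly on `S`. -/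
structure IsAdmissible (S : Set ℂ) (a : ℕ → ℤ) (W : ℝ[X]) : Prop where
  coeff_zero : W.coeff 0 = 1
  summable : ∀ z : ℂ, ‖z‖ < 1 → Summable fun n => (a n : ℂ) * z ^ n
  isAlgebraic_iff : ∀ z : ℂ, ‖z‖ < 1 → aeval z W = 0 → (IsAlgebraic ℚ (intSum a z) ↔ z ∈ S)

lemma exists_quadratic_conj_zeros {α : ℂ} (hα : α ≠ 0) :
    ∃ q : ℝ[X], q.coeff 0 = 1 ∧ ∀ z : ℂ, aeval z q = 0 ↔ z = α ∨ z = conj α := by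
  have hN : Complex.normSq α ≠ 0 := by simpa using hα
  refine ⟨C (Complex.normSq α)⁻¹ * (X ^ 2 - C (2 * α.re) * X + C (Complex.normSq α)), ?_,
    fun z => ?_⟩
  · simp [hN]
  · have h : z ^ 2 - ((2 * α.re : ℝ) : ℂ) * z + (Complex.normSq α : ℂ) =
        (z - α) * (z - conj α) := by
      rw [← Complex.mul_conj, ← Complex.add_conj]
      ring
    have hN' : (((Complex.normSq α)⁻¹ : ℝ) : ℂ) ≠ 0 := by
      exact_mod_cast inv_ne_zero hN
    simp only [map_mul, map_add, map_sub, map_pow, aeval_C, aeval_X, Complex.coe_algebraMap]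
    rw [← Complex.ofReal_mul, h, mul_eq_zero, mul_eq_zero, sub_eq_zero, sub_eq_zero]
    simp only [hN', false_or]

lemma exists_affine_isAlgebraic_iff (p : Prop) (v : ℂ) {u z : ℂ} (hu : u ≠ 0)
    (hreal : z.im = 0 → v.im = 0 ∧ u.im = 0) :
    ∃ a b : ℝ, |a| ≤ 1 ∧ |b| ≤ 1 ∧ (IsAlgebraic ℚ (v + u * (a + b * z)) ↔ p) := by
  by_cases hp : p
  · obtain ⟨a, b, ha, hb, h⟩ := exists_isAlgebraic_affine v hu hreal
    exact ⟨a, b, ha, hb, iff_of_true h hp⟩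
  · obtain ⟨a, ha, h⟩ := exists_transcendental_affine v hu
    exact ⟨a, 0, ha, by simp, iff_of_false (by simpa using h) hp⟩

lemma IsAdmissible.exists_extension {S : Set ℂ} (hS : ∀ α ∈ S, conj α ∈ S) {a : ℕ → ℤ} {W : ℝ[X]}
    (h : IsAdmissible S a W) (α : ℂ) {ε : ℝ} (hε : 0 < ε) :
    ∃ (a' : ℕ → ℤ) (W' : ℝ[X]), IsAdmissible S a' W' ∧ (∀ n, |(a' n : ℝ) - a n| ≤ ε * n) ∧
      (∀ z : ℂ, ‖z‖ < 1 → aeval z W = 0 → aeval z W' = 0 ∧ intSum a' z = intSum a z) ∧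
      (α ≠ 0 → ‖α‖ < 1 → aeval α W' = 0) := by
  by_cases hcase : α ≠ 0 ∧ ‖α‖ < 1 ∧ aeval α W ≠ 0
  swap
  · refine ⟨a, W, h, fun n => by simp; positivity, fun z _ hz => ⟨hz, rfl⟩, fun h0 h1 => ?_⟩
    by_contra h2
    exact hcase ⟨h0, h1, h2⟩
  obtain ⟨hα0, hα1, hαW⟩ := hcase
  obtain ⟨q, hq0, hq⟩ := exists_quadratic_conj_zeros hα0
  have hW'0 : (W * q).coeff 0 = 1 := by rw [mul_coeff_zero, h.coeff_zero, hq0, one_mul]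
  obtain ⟨L, hL⟩ := exists_bounded_int_series (W * q) hW'0
  obtain ⟨B₁, hB₁⟩ := exists_abs_coeff_le W
  obtain ⟨B₂, hB₂⟩ := exists_abs_coeff_le (X * W)
  obtain ⟨N, hN⟩ := exists_nat_ge ((B₁ + B₂ + L) / ε)
  rw [div_le_iff₀' hε] at hN
  have hu : α ^ N * aeval α W ≠ 0 := mul_ne_zero (pow_ne_zero _ hα0) hαW
  obtain ⟨s, t, hs, ht, hst⟩ :=
    exists_affine_isAlgebraic_iff (α ∈ S) (intSum a α) hu fun him => by
      have hc : conj α = α := Complex.conj_eq_iff_im.mpr him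
      rw [← Complex.conj_eq_iff_im, ← Complex.conj_eq_iff_im, ← intSum_conj, map_mul, map_pow,
        ← aeval_conj, hc]
      exact ⟨rfl, rfl⟩
  obtain ⟨g, hg, hgsum⟩ := hL (C s * W + C t * (X * W)) (B₁ + B₂) fun n => by
    rw [coeff_add, coeff_C_mul, coeff_C_mul]
    refine (abs_add_le _ _).trans ?_
    rw [abs_mul, abs_mul]
    exact add_le_add ((mul_le_of_le_one_left (abs_nonneg _) hs).trans (hB₁ n))
      ((mul_le_of_le_one_left (abs_nonneg _) ht).trans (hB₂ n))
  set a' : ℕ → ℤ := fun n => a n + if n < N then 0 else g (n - N) with ha'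
  have hdiff (n : ℕ) : |(a' n : ℝ) - a n| ≤ ε * n := by
    by_cases hn : n < N
    · simp [ha', hn]
      positivity
    · simp only [ha', hn, if_false, Int.cast_add, add_sub_cancel_left]
      have : (N : ℝ) ≤ n := by exact_mod_cast not_lt.mp hn
      calc _ ≤ B₁ + B₂ + L := hg _
        _ ≤ ε * N := hN
        _ ≤ ε * n := by gcongr
  have hval (z : ℂ) (hz : ‖z‖ < 1) (hzW : aeval z (W * q) = 0) :
      intSum a' z = intSum a z + z ^ N * aeval z W * (s + t * z) := by
    have h1 := (h.summable z hz).hasSum.add (hasSum_ite_lt_mul_pow (hgsum z hz hzW) N)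
    have h2 : intSum a' z = _ := HasSum.tsum_eq (by
      convert h1 using 1
      funext n
      rw [ha', ← add_mul, Int.cast_add])
    rw [h2, ← intSum]
    simp only [map_add, map_mul, aeval_C, aeval_X, Complex.coe_algebraMap]
    ring
  have hkeep (z : ℂ) (hz : ‖z‖ < 1) (hzW : aeval z W = 0) :
      aeval z (W * q) = 0 ∧ intSum a' z = intSum a z := by
    have hzW' : aeval z (W * q) = 0 := by rw [map_mul, hzW, zero_mul]
    exact ⟨hzW', by rw [hval z hz hzW', hzW]; ring⟩
  have hαW' : aeval α (W * q) = 0 := by rw [map_mul, (hq α).mpr (Or.inl rfl), mul_zero]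
  have hαiff : IsAlgebraic ℚ (intSum a' α) ↔ α ∈ S := by rw [hval α hα1 hαW', hst]
  refine ⟨a', W * q, ⟨hW'0, fun z hz =>
    (summable_and_norm_intSum_sub_le hdiff hz (h.summable z hz)).1, fun z hz hzW => ?_⟩, hdiff,
    hkeep, fun _ _ => hαW'⟩
  rw [map_mul, mul_eq_zero, hq] at hzW
  rcases hzW with hzW | rfl | rfl
  · rw [(hkeep z hz hzW).2]
    exact h.isAlgebraic_iff z hz hzW
  · exact hαiff
  · rw [intSum_conj, isAlgebraic_conj_iff, hαiff]
    exact ⟨hS α, fun h => by simpa using hS _ h⟩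

lemma exists_limit_of_abs_sub_le {A : ℕ → ℕ → ℤ}
    (hA : ∀ k n, |(A (k + 1) n : ℝ) - A k n| ≤ (1 / 2) ^ k * n) :
    ∃ a : ℕ → ℤ, ∀ k n, |(a n : ℝ) - A k n| ≤ 2 * (1 / 2) ^ k * n := by
  have hdist (n k m : ℕ) :
      |(A (k + m) n : ℝ) - A k n| ≤ 2 * ((1 / 2) ^ k - (1 / 2) ^ (k + m)) * n := by
    induction m with
    | zero => simp
    | succ m ih =>
      have h := abs_sub_le (A (k + (m + 1)) n : ℝ) (A (k + m) n) (A k n)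
      have h' := hA (k + m) n
      rw [add_assoc] at h'
      refine (h.trans (add_le_add h' ih)).trans_eq ?_
      rw [← add_assoc, pow_succ]
      ring
  have hle (n k m : ℕ) : |(A (k + m) n : ℝ) - A k n| ≤ 2 * (1 / 2) ^ k * n := by
    refine (hdist n k m).trans ?_
    gcongr
    simp
  have hstab (n m : ℕ) : A (n + m) n = A n n := by
    induction m with
    | zero => rfl
    | succ m ih =>
      rw [← ih, ← sub_eq_zero, ← Int.abs_lt_one_iff]
      have h := hA (n + m) n
      have hn : (n : ℝ) < 2 ^ (n + m) := by
        exact_mod_cast (Nat.le_add_right n m).trans_lt Nat.lt_two_pow_self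
      have h1 : (1 / 2 : ℝ) ^ (n + m) * n < 1 := by
        rw [one_div, inv_pow, inv_mul_lt_iff₀ (by positivity), mul_one]
        exact hn
      exact_mod_cast h.trans_lt h1
  refine ⟨fun n => A n n, fun k n => ?_⟩
  have h := hle n k n
  rwa [add_comm, hstab] at h

lemma exists_admissible_seq {S : Set ℂ} (hS : ∀ α ∈ S, conj α ∈ S) (α : ℕ → ℂ) :
    ∃ (A : ℕ → ℕ → ℤ) (W : ℕ → ℝ[X]), (∀ n, A 0 n = 2 ^ n.sqrt) ∧
      (∀ k, IsAdmissible S (A k) (W k)) ∧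
      (∀ k n, |(A (k + 1) n : ℝ) - A k n| ≤ (1 / 2) ^ k * n) ∧
      (∀ k (z : ℂ), ‖z‖ < 1 → aeval z (W k) = 0 →
        aeval z (W (k + 1)) = 0 ∧ intSum (A (k + 1)) z = intSum (A k) z) ∧
      ∀ k, α k ≠ 0 → ‖α k‖ < 1 → aeval (α k) (W (k + 1)) = 0 := by
  have hinit : IsAdmissible S (fun n => 2 ^ n.sqrt) 1 := by
    refine ⟨by simp, fun z hz => .of_norm ?_, fun z _ h => by simp at h⟩
    simpa using summable_two_pow_sqrt_mul_pow (norm_nonneg z) hz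
  have hstep (k : ℕ) (x : {p : (ℕ → ℤ) × ℝ[X] // IsAdmissible S p.1 p.2}) :=
    x.2.exists_extension hS (α k) (ε := (1 / 2) ^ k) (by positivity)
  choose a' W' h1 h2 h3 h4 using hstep
  let x : ℕ → {p : (ℕ → ℤ) × ℝ[X] // IsAdmissible S p.1 p.2} := fun k =>
    Nat.rec ⟨(_, _), hinit⟩ (fun k x => ⟨(a' k x, W' k x), h1 k x⟩) k
  exact ⟨fun k => (x k).1.1, fun k => (x k).1.2, fun _ => rfl, fun k => (x k).2,
    fun k => h2 k (x k), fun k => h3 k (x k), fun k => h4 k (x k)⟩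

theorem exists_transcendental_with_exceptional_set (S : Set ℂ)
    (hS : ∀ α ∈ S, IsAlgebraic ℚ α ∧ ‖α‖ < 1)
    (h0 : (0 : ℂ) ∈ S)
    (hconj : ∀ α ∈ S, conj α ∈ S) :
    ∃ (a : ℕ → ℤ) (f : ℂ → ℂ),
      IsIntSeries a f ∧ IsTranscendentalFn f ∧ ExcSet f = S := by
  obtain ⟨α, hα⟩ := Set.countable_iff_exists_subset_range.mp (Algebraic.countable ℚ ℂ)
  obtain ⟨A, W, hA0, hadm, hdiff, hkeep, hzero⟩ := exists_admissible_seq hconj α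
  obtain ⟨a, ha⟩ := exists_limit_of_abs_sub_le hdiff
  have hsum : IsIntSeries a (intSum a) := fun z hz =>
    (summable_and_norm_intSum_sub_le (ha 0) hz ((hadm 0).summable z hz)).1.hasSum
  have hconst (k : ℕ) (z : ℂ) (hz : ‖z‖ < 1) (hzW : aeval z (W k) = 0) :
      intSum a z = intSum (A k) z := by
    have hm (m : ℕ) : aeval z (W (k + m)) = 0 ∧ intSum (A (k + m)) z = intSum (A k) z := by
      induction m with
      | zero => exact ⟨hzW, rfl⟩
      | succ m ih =>
        obtain ⟨h1, h2⟩ := hkeep (k + m) z hz ih.1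
        exact ⟨h1, h2.trans ih.2⟩
    have hlim : Tendsto (fun m : ℕ => 2 * (1 / 2 : ℝ) ^ (k + m) * (‖z‖ / (1 - ‖z‖) ^ 2)) atTop
        (𝓝 0) := by
      have h := tendsto_pow_atTop_nhds_zero_of_lt_one (r := (1 / 2 : ℝ)) (by norm_num) (by norm_num)
      simpa [add_comm] using
        ((h.comp (tendsto_add_atTop_nat k)).const_mul 2).mul_const (‖z‖ / (1 - ‖z‖) ^ 2)
    have hle : ‖intSum a z - intSum (A k) z‖ ≤ 0 := ge_of_tendsto' hlim fun m => by
      rw [← (hm m).2]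
      exact (summable_and_norm_intSum_sub_le (ha (k + m)) hz ((hadm (k + m)).summable z hz)).2
    exact sub_eq_zero.mp (norm_le_zero_iff.mp hle)
  have hiff (z : ℂ) (hz : ‖z‖ < 1) (hzalg : IsAlgebraic ℚ z) :
      IsAlgebraic ℚ (intSum a z) ↔ z ∈ S := by
    rcases eq_or_ne z 0 with rfl | hz0
    · refine iff_of_true ?_ h0
      rw [intSum, tsum_eq_single 0 fun n hn => by simp [hn]]
      simpa using isAlgebraic_intCast (R := ℚ) (A := ℂ) (a 0)
    · obtain ⟨k, rfl⟩ := hα hzalg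
      have hk := hzero k hz0 hz
      rw [hconst (k + 1) _ hz hk]
      exact (hadm (k + 1)).isAlgebraic_iff _ hz hk
  refine ⟨a, intSum a, hsum, isTranscendentalFn_of_frequently_lt
    (frequently_lt_of_abs_sub_two_pow_sqrt_le (fun n => ?_) hsum), ?_⟩
  · simpa [hA0] using ha 0 n
  · ext z
    exact ⟨fun ⟨hz1, hz2, hz3⟩ => (hiff z hz2 hz1).mp hz3, fun hz =>
      ⟨(hS z hz).1, (hS z hz).2, (hiff z (hS z hz).2 (hS z hz).1).mpr hz⟩⟩
end

section
/- Let α be an algebraic number with |α| < 1. Then there exists a function f ∈ ℤ{z} such that for every algebraic number z with |z| < 1, one has f(z) = 0 if and only if z = α or z equals the complex conjugate of α; moreover, there exists a constant C > 0 such that |f(z)| ≤ C/(1 − |z|)³ for all z with |z| < 1. -/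
open ComplexConjugate

open Topology

/-- Coefficients of a power series `G` such that `(1 + p z + q z²) G` has integer coefficients.
The sequence `b` decides whether the `n`-th coefficient is the smallest nonnegative admissible one
or the one exceeding it by `n`. -/
noncomputable def cofactorCoeff (p q : ℝ) (b : ℕ → Bool) : ℕ → ℝ
  | 0 => 1
  | 1 => Int.fract (-p) + if b 1 then 1 else 0
  | n + 2 => Int.fract (-(p * cofactorCoeff p q b (n + 1) + q * cofactorCoeff p q b n)) +
      if b (n + 2) then ((n + 2 : ℕ) : ℝ) else 0

/-- The coefficient sequence of `z * G`, where `c` is that of `G`. -/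
def shiftCoeff (c : ℕ → ℝ) : ℕ → ℝ
  | 0 => 0
  | n + 1 => c n

lemma hasSum_shiftCoeff {c : ℕ → ℝ} {z s : ℂ} (h : HasSum (fun n => (c n : ℂ) * z ^ n) s) :
    HasSum (fun n => (shiftCoeff c n : ℂ) * z ^ n) (z * s) := by
  rw [← hasSum_nat_add_iff' 1]
  simpa [shiftCoeff, pow_succ, mul_left_comm, mul_comm] using h.mul_left z

lemma cofactorCoeff_eq_fract_add (p q : ℝ) (b : ℕ → Bool) {n : ℕ} (hn : n ≠ 0) :
    cofactorCoeff p q b n =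
      Int.fract (-(p * shiftCoeff (cofactorCoeff p q b) n +
        q * shiftCoeff (shiftCoeff (cofactorCoeff p q b)) n)) + if b n then (n : ℝ) else 0 := by
  match n, hn with
  | 1, _ => simp [cofactorCoeff, shiftCoeff]
  | n + 2, _ => simp [cofactorCoeff, shiftCoeff]

lemma exists_int_eq_cofactorCoeff (p q : ℝ) (b : ℕ → Bool) (n : ℕ) :
    ∃ m : ℤ, (m : ℝ) = cofactorCoeff p q b n + p * shiftCoeff (cofactorCoeff p q b) n +
      q * shiftCoeff (shiftCoeff (cofactorCoeff p q b)) n := by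
  rcases eq_or_ne n 0 with rfl | hn
  · exact ⟨1, by simp [cofactorCoeff, shiftCoeff]⟩
  · set x := p * shiftCoeff (cofactorCoeff p q b) n +
      q * shiftCoeff (shiftCoeff (cofactorCoeff p q b)) n with hx
    refine ⟨-⌊-x⌋ + if b n then (n : ℤ) else 0, ?_⟩
    rw [add_assoc, ← hx, cofactorCoeff_eq_fract_add p q b hn, ← hx, Int.fract]
    split_ifs <;> push_cast <;> ring

lemma abs_cofactorCoeff_le (p q : ℝ) (b : ℕ → Bool) (n : ℕ) :
    |cofactorCoeff p q b n| ≤ n + 1 := by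
  rcases eq_or_ne n 0 with rfl | hn
  · simp [cofactorCoeff]
  · rw [cofactorCoeff_eq_fract_add p q b hn, abs_le]
    set x := -(p * shiftCoeff (cofactorCoeff p q b) n +
      q * shiftCoeff (shiftCoeff (cofactorCoeff p q b)) n)
    have h0 := Int.fract_nonneg x
    have h1 := Int.fract_lt_one x
    have h2 : (0 : ℝ) ≤ n := n.cast_nonneg
    split_ifs <;> constructor <;> linarith

lemma cofactorCoeff_congr (p q : ℝ) {b b' : ℕ → Bool} :
    ∀ n : ℕ, (∀ i ≤ n, b i = b' i) → cofactorCoeff p q b n = cofactorCoeff p q b' n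
  | 0, _ => rfl
  | 1, h => by simp [cofactorCoeff, h 1 le_rfl]
  | n + 2, h => by
    simp [cofactorCoeff, h (n + 2) le_rfl,
      cofactorCoeff_congr p q (n + 1) fun i hi => h i (by omega),
      cofactorCoeff_congr p q n fun i hi => h i (by omega)]

lemma continuous_cofactorCoeff (p q : ℝ) (n : ℕ) :
    Continuous fun b : ℕ → Bool => cofactorCoeff p q b n := by
  refine IsLocallyConstant.continuous ((IsLocallyConstant.iff_eventually_eq _).2 fun b => ?_)
  have h : ∀ᶠ b' in 𝓝 b, ∀ i ∈ Set.Iic n, b' i = b i :=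
    (Filter.eventually_all_finite (Set.finite_Iic n)).2 fun i _ =>
      Filter.tendsto_pure.1 (nhds_discrete Bool ▸ (continuous_apply i).tendsto b)
  filter_upwards [h] with b' hb'
  exact cofactorCoeff_congr p q n hb'

lemma hasSum_succ_mul_geometric {r : ℝ} (h0 : 0 ≤ r) (h1 : r < 1) :
    HasSum (fun n : ℕ => ((n : ℝ) + 1) * r ^ n) (1 / (1 - r) ^ 2) := by
  have hr : ‖r‖ < 1 := by rwa [Real.norm_of_nonneg h0]
  have h := (hasSum_coe_mul_geometric_of_norm_lt_one hr).add (hasSum_geometric_of_lt_one h0 h1)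
  have hne : 1 - r ≠ 0 := by linarith
  have hval : 1 / (1 - r) ^ 2 = r / (1 - r) ^ 2 + (1 - r)⁻¹ := by
    field_simp
    ring
  rw [hval]
  exact h.congr_fun fun n => by ring

/-- The sum of the power series with coefficients `cofactorCoeff p q b`. -/
noncomputable def cofactor (p q : ℝ) (b : ℕ → Bool) (z : ℂ) : ℂ :=
  ∑' n, (cofactorCoeff p q b n : ℂ) * z ^ n

lemma norm_cofactorCoeff_mul_le (p q : ℝ) (b : ℕ → Bool) (z : ℂ) (n : ℕ) :
    ‖(cofactorCoeff p q b n : ℂ) * z ^ n‖ ≤ ((n : ℝ) + 1) * ‖z‖ ^ n := by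
  rw [norm_mul, norm_pow, Complex.norm_real, Real.norm_eq_abs]
  gcongr
  exact abs_cofactorCoeff_le p q b n

lemma hasSum_cofactor (p q : ℝ) (b : ℕ → Bool) {z : ℂ} (hz : ‖z‖ < 1) :
    HasSum (fun n => (cofactorCoeff p q b n : ℂ) * z ^ n) (cofactor p q b z) :=
  (Summable.of_norm_bounded (hasSum_succ_mul_geometric (norm_nonneg z) hz).summable
    (norm_cofactorCoeff_mul_le p q b z)).hasSum

lemma norm_cofactor_le (p q : ℝ) (b : ℕ → Bool) {z : ℂ} (hz : ‖z‖ < 1) :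
    ‖cofactor p q b z‖ ≤ 1 / (1 - ‖z‖) ^ 2 :=
  tsum_of_norm_bounded (hasSum_succ_mul_geometric (norm_nonneg z) hz)
    (norm_cofactorCoeff_mul_le p q b z)

lemma cofactor_zero (p q : ℝ) (b : ℕ → Bool) : cofactor p q b 0 = 1 := by
  rw [cofactor, tsum_eq_single 0 fun n hn => by simp [hn]]
  simp [cofactorCoeff]

lemma continuous_cofactor (p q : ℝ) {z : ℂ} (hz : ‖z‖ < 1) :
    Continuous fun b => cofactor p q b z :=
  continuous_tsum
    (fun n => (Complex.continuous_ofReal.comp (continuous_cofactorCoeff p q n)).mul_const _)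
    (hasSum_succ_mul_geometric (norm_nonneg z) hz).summable
    fun n b => norm_cofactorCoeff_mul_le p q b z n

/-- Two choices differing at `N`, both choosing the smallest coefficient afterwards, cannot both
lead to a series vanishing at `z` once `N` is large. -/
lemma cofactor_ne_of_eq_of_lt (p q : ℝ) {z : ℂ} (hz : ‖z‖ < 1) (hz0 : z ≠ 0) {N : ℕ}
    (hN : ‖z‖ / (1 - ‖z‖) < N) {b b' : ℕ → Bool} (hlt : ∀ i < N, b i = b' i)
    (hb : b N = true) (hb' : b' N = false) (hgt : ∀ i, N < i → b i = false)
    (hgt' : ∀ i, N < i → b' i = false) : cofactor p q b z ≠ cofactor p q b' z := by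
  intro heq
  have hr0 := norm_nonneg z
  have hN0 : N ≠ 0 := by
    rintro rfl
    have : 0 ≤ ‖z‖ / (1 - ‖z‖) := div_nonneg hr0 (by linarith)
    simp only [Nat.cast_zero] at hN
    linarith
  have hcong : ∀ i < N, cofactorCoeff p q b i = cofactorCoeff p q b' i := fun i hi =>
    cofactorCoeff_congr p q i fun j hj => hlt j (by omega)
  have hdiff : cofactorCoeff p q b N = cofactorCoeff p q b' N + N := by
    have h1 : shiftCoeff (cofactorCoeff p q b) N = shiftCoeff (cofactorCoeff p q b') N := by
      match N, hcong with
      | 0, _ => rfl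
      | n + 1, h => exact h n (by omega)
    have h2 : shiftCoeff (shiftCoeff (cofactorCoeff p q b)) N =
        shiftCoeff (shiftCoeff (cofactorCoeff p q b')) N := by
      match N, hcong with
      | 0, _ => rfl
      | 1, _ => rfl
      | n + 2, h => exact h n (by omega)
    rw [cofactorCoeff_eq_fract_add p q b hN0, cofactorCoeff_eq_fract_add p q b' hN0, h1, h2, hb,
      hb']
    simp
  have hD : ∀ i, N < i → |cofactorCoeff p q b i - cofactorCoeff p q b' i| ≤ 1 := by
    intro i hi
    rw [cofactorCoeff_eq_fract_add p q b (by omega), cofactorCoeff_eq_fract_add p q b' (by omega),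
      hgt i hi, hgt' i hi]
    simp only [Bool.false_eq_true, if_false, add_zero]
    exact (abs_sub_lt_of_nonneg_of_lt (Int.fract_nonneg _) (Int.fract_lt_one _)
      (Int.fract_nonneg _) (Int.fract_lt_one _)).le
  have hsum := (hasSum_cofactor p q b hz).sub (hasSum_cofactor p q b' hz)
  rw [heq, sub_self, ← hasSum_nat_add_iff' (N + 1), Finset.sum_range_succ,
    Finset.sum_eq_zero fun i hi => by rw [hcong i (Finset.mem_range.1 hi), sub_self], hdiff] at hsum
  have hgeo := (hasSum_geometric_of_lt_one hr0 hz).mul_left (‖z‖ ^ (N + 1))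
  have hle := tsum_of_norm_bounded hgeo (f := fun n =>
      (cofactorCoeff p q b (n + (N + 1)) : ℂ) * z ^ (n + (N + 1)) -
      (cofactorCoeff p q b' (n + (N + 1)) : ℂ) * z ^ (n + (N + 1))) fun n => by
    rw [← sub_mul, norm_mul, ← Complex.ofReal_sub, Complex.norm_real, norm_pow, Real.norm_eq_abs,
      ← pow_add, add_comm n]
    exact mul_le_of_le_one_left (by positivity) (hD _ (by omega))
  rw [hsum.tsum_eq] at hle
  have hval : ‖(0 : ℂ) - (0 + (((cofactorCoeff p q b' N + N : ℝ) : ℂ) * z ^ N -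
      (cofactorCoeff p q b' N : ℂ) * z ^ N))‖ = N * ‖z‖ ^ N := by
    rw [zero_add, zero_sub, norm_neg, ← sub_mul, ← Complex.ofReal_sub, add_sub_cancel_left,
      norm_mul, norm_pow, Complex.ofReal_natCast, Complex.norm_natCast]
  rw [hval, pow_succ, mul_assoc, ← div_eq_mul_inv, mul_comm] at hle
  exact hN.not_ge (le_of_mul_le_mul_left hle (pow_pos (norm_pos_iff.2 hz0) N))

lemma interior_cofactor_eq_zero (p q : ℝ) {z : ℂ} (hz : ‖z‖ < 1) :
    interior {b | cofactor p q b z = 0} = ∅ := by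
  rcases eq_or_ne z 0 with rfl | hz0
  · simp [cofactor_zero]
  rw [Set.eq_empty_iff_forall_notMem]
  intro b hb
  obtain ⟨M, hM⟩ := exists_nat_gt (‖z‖ / (1 - ‖z‖))
  have htend : ∀ t : Bool, Filter.Tendsto
      (fun N i => if i < N then b i else if i = N then t else false) Filter.atTop (𝓝 b) := by
    refine fun t => tendsto_pi_nhds.2 fun i => tendsto_const_nhds.congr' ?_
    filter_upwards [Filter.eventually_gt_atTop i] with N hN
    simp [hN]
  have hmem := mem_interior_iff_mem_nhds.1 hb
  obtain ⟨N, hN, h1, h2⟩ := ((Filter.eventually_ge_atTop M).and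
    (((htend true).eventually hmem).and ((htend false).eventually hmem))).exists
  refine cofactor_ne_of_eq_of_lt p q hz hz0 (hM.trans_le (Nat.cast_le.2 hN)) ?_ ?_ ?_ ?_ ?_
    (h1.trans h2.symm)
  · intro i hi
    simp [hi]
  · simp
  · simp
  · intro i hi
    simp [hi.not_gt, hi.ne']
  · intro i hi
    simp [hi.not_gt]

lemma exists_cofactor_ne_zero (p q : ℝ) {S : Set ℂ} (hS : S.Countable) :
    ∃ b, ∀ z ∈ S, ‖z‖ < 1 → cofactor p q b z ≠ 0 := by
  by_contra! h
  have hT : (S ∩ Metric.ball 0 1).Countable := hS.mono Set.inter_subset_left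
  have hcover : ⋃ z ∈ S ∩ Metric.ball 0 1, {b | cofactor p q b z = 0} = Set.univ := by
    refine Set.eq_univ_of_forall fun b => ?_
    obtain ⟨z, hzS, hz, h0⟩ := h b
    exact Set.mem_biUnion ⟨hzS, mem_ball_zero_iff.2 hz⟩ h0
  obtain ⟨b, hb⟩ := (dense_biUnion_interior_of_closed
    (fun z hz => isClosed_eq (continuous_cofactor p q (mem_ball_zero_iff.1 hz.2))
      continuous_const) hT hcover).nonempty
  obtain ⟨z, hz, hbz⟩ := Set.mem_iUnion₂.1 hb
  rw [interior_cofactor_eq_zero p q (mem_ball_zero_iff.1 hz.2)] at hbz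
  exact hbz

theorem exists_intSeries_vanishing_exactly_at_alpha_conj_alpha (α : ℂ)
    (halg : IsAlgebraic ℚ α) (hα : ‖α‖ < 1) :
    ∃ (a : ℕ → ℤ) (f : ℂ → ℂ), IsIntSeries a f ∧
      (∀ z : ℂ, IsAlgebraic ℚ z → ‖z‖ < 1 → (f z = 0 ↔ z = α ∨ z = conj α)) ∧
      ∃ C : ℝ, 0 < C ∧ ∀ z : ℂ, ‖z‖ < 1 → ‖f z‖ ≤ C / (1 - ‖z‖) ^ 3 := by
  rcases eq_or_ne α 0 with rfl | h0
  · refine ⟨Pi.single 1 1, id, fun z _ => ?_, by simp, 1, one_pos, fun z hz => ?_⟩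
    · convert hasSum_single (f := fun n => ((Pi.single 1 1 : ℕ → ℤ) n : ℂ) * z ^ n) 1
        fun n hn => by simp [hn] using 1
      simp
    · have hr := norm_nonneg z
      exact hz.le.trans
        ((one_le_div (by have := sub_pos.2 hz; positivity)).2 (pow_le_one₀ (by linarith)
          (by linarith)))
  have hc0 : conj α ≠ 0 := (map_ne_zero _).2 h0
  set p : ℝ := -(2 * α.re) / Complex.normSq α
  set q : ℝ := 1 / Complex.normSq α
  have hfactor : ∀ z : ℂ, 1 + p * z + q * z ^ 2 = (z - α) * (z - conj α) / (α * conj α) := by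
    intro z
    have hre : ((2 * α.re : ℝ) : ℂ) = α + conj α := (Complex.add_conj α).symm
    simp only [p, q, Complex.ofReal_div, Complex.ofReal_neg, hre, ← Complex.mul_conj,
      Complex.ofReal_one]
    field_simp
    ring
  obtain ⟨b, hb⟩ := exists_cofactor_ne_zero p q (Algebraic.countable ℚ ℂ)
  choose a ha using exists_int_eq_cofactorCoeff p q b
  refine ⟨a, fun z => (1 + p * z + q * z ^ 2) * cofactor p q b z, fun z hz => ?_,
    fun z hzalg hz => ?_, 1 + |p| + |q|, by positivity, fun z hz => ?_⟩
  · have h1 := hasSum_cofactor p q b hz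
    have h2 := hasSum_shiftCoeff h1
    have h3 := hasSum_shiftCoeff h2
    convert (h1.add (h2.mul_left (p : ℂ))).add (h3.mul_left (q : ℂ)) using 1
    · funext n
      rw [← Complex.ofReal_intCast, ha]
      push_cast
      ring
    · ring
  · rw [mul_eq_zero, or_iff_left (hb z hzalg hz), hfactor, div_eq_zero_iff,
      or_iff_left (mul_ne_zero h0 hc0), mul_eq_zero, sub_eq_zero, sub_eq_zero]
  · have hr := norm_nonneg z
    have hpos : 0 < 1 - ‖z‖ := sub_pos.2 hz
    have hQ : ‖1 + p * z + q * z ^ 2‖ ≤ 1 + |p| + |q| := by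
      refine norm_add₃_le.trans ?_
      rw [norm_one, norm_mul, norm_mul, norm_pow, Complex.norm_real, Complex.norm_real,
        Real.norm_eq_abs, Real.norm_eq_abs]
      gcongr
      · exact mul_le_of_le_one_right (abs_nonneg p) hz.le
      · exact mul_le_of_le_one_right (abs_nonneg q) (pow_le_one₀ hr hz.le)
    rw [norm_mul, div_eq_mul_one_div]
    refine mul_le_mul hQ ((norm_cofactor_le p q b hz).trans ?_) (norm_nonneg _) (by positivity)
    exact one_div_le_one_div_of_le (by positivity)
      (pow_le_pow_of_le_one hpos.le (by linarith) (by norm_num))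
end
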